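/- Let F be a field and n ≥ 1. Let ε^X_J, ε*^X_J, ε^Y_J, ε*^Y_J ∈ F be families indexed by the intervals of {1,…,n} (conventions ε_∅ = ε*_∅ = 1) such that both pairs (ε^X, ε*^X) and (ε^Y, ε*^Y) satisfy Σ_{j=s−1}^{t} (−1)^{j−s+1} ε_{[s,j]} ε*_{[j+1,t]} = 0 for all 1 ≤ s ≤ t ≤ n, and let γ₁, …, γ_n ∈ F be nonzero. Define Z_{[s,t]} := Σ_{k=s−1}^{t} ε^Y_{[s,k]} ε^X_{[k+1,t]} / Π_{j=s}^{k} γ_j and Z*_{[s,t]} := Σ_{k=s−1}^{t} ε*^X_{[s,k]} ε*^Y_{[k+1,t]} / Π_{j=k+1}^{t} γ_j. Then Σ_{j=s−1}^{t} (−1)^{j−s+1} Z_{[s,j]} Z*_{[j+1,t]} = 0 for all 1 ≤ s ≤ t ≤ n; equivalently, Z*_J = Σ_{P partition of J} (−1)^{|J|−l(P)} Z_P for every interval J. -/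

import Mathlib

open Finset

namespace EpsSys

/-- All partitions of the interval `[s,t]` into consecutive blocks `(a,b)` (meaning `{a,…,b}`),
listed left to right; the first argument is fuel. For the empty interval (`t < s`) the only
partition is the empty list. -/
def partitionsAux : ℕ → ℕ → ℕ → List (List (ℕ × ℕ))
  | 0, _, _ => [[]]
  | fuel+1, s, t =>
    if t < s then [[]]
    else (List.range (t + 1 - s)).flatMap fun d =>
      (partitionsAux fuel (s + d + 1) t).map (fun P => (s, s + d) :: P)

/-- The list of all partitions of the interval `[s,t]`. -/
def partitions (s t : ℕ) : List (List (ℕ × ℕ)) :=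
  partitionsAux (t + 1 - s) s t

variable {A : Type*} [CommRing A]

/-- `ε_P`: the product of `ε` over the blocks of a partition `P`. -/
def epsP (eps : ℕ → ℕ → A) (P : List (ℕ × ℕ)) : A :=
  (P.map fun p => eps p.1 p.2).prod

/-- The partition sum `ε*_{[s,t]} = Σ_{P partition of [s,t]} (−1)^{|J| − l(P)} ε_P`.
For the empty interval (`t < s`) this equals `1`. -/
def epsStar (eps : ℕ → ℕ → A) (s t : ℕ) : A :=
  ((partitions s t).map fun P => (-1 : A) ^ (t + 1 - s - P.length) * epsP eps P).sum

/-- Extension of a family indexed by intervals by the convention `ε_∅ = 1`. -/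
def epsE (eps : ℕ → ℕ → A) (s t : ℕ) : A :=
  if t < s then 1 else eps s t

end EpsSys


open EpsSys Finset

namespace EpsSys

variable {F : Type*} [Field F]

/-- The product family `Z_{[s,t]} := Σ_{k=s−1}^{t} ε^Y_{[s,k]} ε^X_{[k+1,t]} / Π_{j=s}^{k} γ_j`
(with the conventions `ε_∅ = 1` built in via `epsE`; note `Z_{[s,t]} = 1` when `t < s ≤ t+1`). -/
def Zfun (epsY epsX : ℕ → ℕ → F) (γ : ℕ → F) (s t : ℕ) : F :=
  ∑ k ∈ Finset.Icc (s - 1) t,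
    epsE epsY s k * epsE epsX (k + 1) t / ∏ j ∈ Finset.Icc s k, γ j

/-- The product family
`Z*_{[s,t]} := Σ_{k=s−1}^{t} ε*^X_{[s,k]} ε*^Y_{[k+1,t]} / Π_{j=k+1}^{t} γ_j`. -/
def ZstarFun (epsStarX epsStarY : ℕ → ℕ → F) (γ : ℕ → F) (s t : ℕ) : F :=
  ∑ k ∈ Finset.Icc (s - 1) t,
    epsE epsStarX s k * epsE epsStarY (k + 1) t / ∏ j ∈ Finset.Icc (k + 1) t, γ j

end EpsSys

namespace EpsSys

section PartitionSums

variable {A : Type*} [CommRing A]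

lemma partitionsAux_of_lt {s t : ℕ} (h : t < s) (m : ℕ) : partitionsAux m s t = [[]] := by
  cases m <;> simp [partitionsAux, h]

/-- Any sufficient amount of fuel produces the same list of partitions. -/
lemma partitionsAux_eq_partitions (m s t : ℕ) (hm : t + 1 - s ≤ m) :
    partitionsAux m s t = partitions s t := by
  suffices H : ∀ m m' s, t + 1 - s ≤ m → t + 1 - s ≤ m' →
      partitionsAux m s t = partitionsAux m' s t from H _ _ _ hm le_rfl
  intro m
  induction m with
  | zero =>
    intro m' s h _
    rw [partitionsAux_of_lt (by omega), partitionsAux_of_lt (by omega)]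
  | succ m ih =>
    intro m' s h h'
    rcases lt_or_ge t s with hts | hst
    · rw [partitionsAux_of_lt hts, partitionsAux_of_lt hts]
    · obtain ⟨m', rfl⟩ : ∃ k, m' = k + 1 := ⟨m' - 1, by omega⟩
      simp only [partitionsAux, if_neg hst.not_gt]
      congr 1
      funext d
      rw [ih m' (s + d + 1) (by omega) (by omega)]

lemma partitions_of_lt {s t : ℕ} (h : t < s) : partitions s t = [[]] :=
  partitionsAux_of_lt h _

/-- A partition of a nonempty interval is a first block followed by a partition of the rest. -/
lemma partitions_of_le {s t : ℕ} (h : s ≤ t) :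
    partitions s t = (List.range (t + 1 - s)).flatMap fun d =>
      (partitions (s + d + 1) t).map fun P => (s, s + d) :: P := by
  rw [← partitionsAux_eq_partitions (t - s + 1) s t (by omega)]
  simp only [partitionsAux, if_neg h.not_gt]
  congr 1
  funext d
  rw [partitionsAux_eq_partitions _ _ _ (by omega)]

lemma length_le_of_mem_partitions {s t : ℕ} {P : List (ℕ × ℕ)} (hP : P ∈ partitions s t) :
    P.length ≤ t + 1 - s := by
  induction P generalizing s with
  | nil => simp
  | cons p P ih =>
    rcases lt_or_ge t s with hts | hst
    · simp [partitions_of_lt hts] at hP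
    · rw [partitions_of_le hst] at hP
      simp only [List.mem_flatMap, List.mem_range, List.mem_map, List.cons.injEq] at hP
      obtain ⟨d, hd, Q, hQ, -, rfl⟩ := hP
      have := ih hQ
      simp only [List.length_cons]
      omega

lemma epsStar_of_lt (eps : ℕ → ℕ → A) {s t : ℕ} (h : t < s) : epsStar eps s t = 1 := by
  simp [epsStar, partitions_of_lt h, epsP, Nat.sub_eq_zero_of_le (Nat.succ_le_of_lt h)]

lemma _root_.List.sum_flatMap_map_range {β : Type*} (m : ℕ) (l : ℕ → List β) (f : β → A) :
    (((List.range m).flatMap l).map f).sum = ∑ d ∈ Finset.range m, ((l d).map f).sum := by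
  induction m with
  | zero => simp
  | succ m ih => simp [List.range_succ, Finset.sum_range_succ, ih]

/-- The partition sum, expanded along the first block. -/
lemma epsStar_of_le (eps : ℕ → ℕ → A) {s t : ℕ} (h : s ≤ t) :
    epsStar eps s t = ∑ d ∈ Finset.range (t + 1 - s),
      (-1) ^ d * eps s (s + d) * epsStar eps (s + d + 1) t := by
  rw [epsStar, partitions_of_le h, List.sum_flatMap_map_range]
  refine Finset.sum_congr rfl fun d hd => ?_
  rw [Finset.mem_range] at hd
  rw [epsStar, ← List.sum_map_mul_left, List.map_map]
  refine congrArg List.sum (List.map_congr_left fun P hP => ?_)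
  have hlen := length_le_of_mem_partitions hP
  have hexp : t + 1 - s - (P.length + 1) = d + (t + 1 - (s + d + 1) - P.length) := by omega
  simp only [Function.comp_apply, List.length_cons, hexp, pow_add, epsP, List.map_cons,
    List.prod_cons]
  ring

/-- The alternating convolution relation determines the second family as the partition sum
of the first. -/
lemma eq_epsStar_of_alternating_sum_eq_zero {n : ℕ} {z w : ℕ → ℕ → A}
    (hz : ∀ s, 1 ≤ s → z s (s - 1) = 1) (hw : ∀ t, w (t + 1) t = 1)
    (h : ∀ s t, 1 ≤ s → s ≤ t → t ≤ n →
      ∑ j ∈ Finset.Icc (s - 1) t, (-1) ^ (j + 1 - s) * z s j * w (j + 1) t = 0)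
    {s t : ℕ} (hs : 1 ≤ s) (hst : s ≤ t + 1) (ht : t ≤ n) :
    w s t = epsStar z s t := by
  induction hm : t + 1 - s using Nat.strong_induction_on generalizing s with
  | _ m ih =>
    rcases hst.eq_or_lt with rfl | hlt
    · rw [hw, epsStar_of_lt _ (Nat.lt_succ_self t)]
    · have hle : s ≤ t := Nat.lt_succ_iff.mp hlt
      have key := h s t hs hle ht
      rw [← Finset.Ico_succ_right_eq_Icc, Finset.sum_Ico_eq_sum_range] at key
      have hlen : Order.succ t - (s - 1) = (t + 1 - s) + 1 := by
        rw [Nat.succ_eq_succ]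
        omega
      rw [hlen, Finset.sum_range_succ'] at key
      simp only [Nat.add_zero, Nat.sub_add_cancel hs, Nat.sub_self, pow_zero, one_mul,
        hz s hs] at key
      rw [epsStar_of_le z hle, eq_neg_of_add_eq_zero_right key, ← Finset.sum_neg_distrib]
      refine Finset.sum_congr rfl fun d hd => ?_
      rw [Finset.mem_range] at hd
      have h1 : s - 1 + (d + 1) = s + d := by omega
      have h2 : s + d + 1 - s = d + 1 := by omega
      rw [h1, h2, ih (t + 1 - (s + d + 1)) (by omega) (by omega) (by omega) rfl]
      ring

end PartitionSums

section Convolution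

variable {A : Type*} [CommRing A]

/-- The element of the incidence algebra of `ℕ` with entries `f a b` for `a ≤ b`. -/
def toIncidence (f : ℕ → ℕ → A) : IncidenceAlgebra A ℕ where
  toFun a b := if a ≤ b then f a b else 0
  eq_zero_of_not_le' _ _ h := if_neg h

lemma toIncidence_apply (f : ℕ → ℕ → A) {a b : ℕ} (h : a ≤ b) : toIncidence f a b = f a b :=
  if_pos h

lemma toIncidence_mul_apply (f g : ℕ → ℕ → A) (a b : ℕ) :
    (toIncidence f * toIncidence g) a b = ∑ k ∈ Finset.Icc a b, f a k * g k b := by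
  rw [IncidenceAlgebra.mul_apply]
  refine Finset.sum_congr rfl fun k hk => ?_
  rw [Finset.mem_Icc] at hk
  rw [toIncidence_apply _ hk.1, toIncidence_apply _ hk.2]

lemma mul_apply_of_eq_one {f g : IncidenceAlgebra A ℕ} {a b : ℕ}
    (h : ∀ k ≤ b, f a k = (1 : IncidenceAlgebra A ℕ) a k) : (f * g) a b = g a b := by
  conv_rhs => rw [← one_mul g]
  rw [IncidenceAlgebra.mul_apply, IncidenceAlgebra.mul_apply]
  exact Finset.sum_congr rfl fun k hk => by rw [h k (Finset.mem_Icc.mp hk).2]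

lemma epsE_succ_self (eps : ℕ → ℕ → A) (t : ℕ) : epsE eps (t + 1) t = 1 :=
  if_pos (Nat.lt_succ_self t)

/-- The alternating convolution relation as an inverse relation in the incidence algebra. -/
lemma toIncidence_mul_eq_one {n : ℕ} {e e' : ℕ → ℕ → A}
    (h : ∀ s t : ℕ, 1 ≤ s → s ≤ t → t ≤ n →
      ∑ j ∈ Finset.Icc (s - 1) t,
        (-1) ^ (j + 1 - s) * epsE e s j * epsE e' (j + 1) t = 0) (a b : ℕ) (hb : b ≤ n) :
    (toIncidence (fun a b => (-1) ^ (b - a) * epsE e (a + 1) b) *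
      toIncidence (fun a b => epsE e' (a + 1) b)) a b = (1 : IncidenceAlgebra A ℕ) a b := by
  rcases lt_trichotomy a b with hab | rfl | hab
  · rw [toIncidence_mul_apply, IncidenceAlgebra.one_apply, if_neg hab.ne]
    simpa using h (a + 1) b (by omega) hab hb
  · rw [toIncidence_mul_apply]
    simp [epsE_succ_self]
  · rw [IncidenceAlgebra.apply_eq_zero_of_not_le hab.not_ge,
      IncidenceAlgebra.apply_eq_zero_of_not_le hab.not_ge]

lemma prod_Icc_succ_mul_prod_Icc_succ (γ : ℕ → A) {a k b : ℕ} (hak : a ≤ k) (hkb : k ≤ b) :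
    (∏ j ∈ Finset.Icc (a + 1) k, γ j) * ∏ j ∈ Finset.Icc (k + 1) b, γ j
      = ∏ j ∈ Finset.Icc (a + 1) b, γ j := by
  simp only [← Finset.Ico_succ_right_eq_Icc, Nat.succ_eq_succ, Nat.succ_eq_add_one]
  exact Finset.prod_Ico_consecutive γ (by omega) (by omega)

end Convolution

section Product

variable {F : Type*} [Field F]

/-- Dividing both factors by interval products of `γ` divides their convolution likewise. -/
lemma toIncidence_div_prod_mul_apply (f g : ℕ → ℕ → F) (γ : ℕ → F) (a b : ℕ) :
    (toIncidence (fun a b => f a b / ∏ j ∈ Finset.Icc (a + 1) b, γ j) *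
      toIncidence (fun a b => g a b / ∏ j ∈ Finset.Icc (a + 1) b, γ j)) a b
      = (toIncidence f * toIncidence g) a b / ∏ j ∈ Finset.Icc (a + 1) b, γ j := by
  rw [toIncidence_mul_apply, toIncidence_mul_apply, Finset.sum_div]
  refine Finset.sum_congr rfl fun k hk => ?_
  rw [Finset.mem_Icc] at hk
  rw [div_mul_div_comm, prod_Icc_succ_mul_prod_Icc_succ γ hk.1 hk.2]

lemma Zfun_succ_self (epsY epsX : ℕ → ℕ → F) (γ : ℕ → F) (t : ℕ) :
    Zfun epsY epsX γ (t + 1) t = 1 := by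
  simp [Zfun, epsE_succ_self]

lemma ZstarFun_succ_self (epsStarX epsStarY : ℕ → ℕ → F) (γ : ℕ → F) (t : ℕ) :
    ZstarFun epsStarX epsStarY γ (t + 1) t = 1 := by
  simp [ZstarFun, epsE_succ_self]

lemma toIncidence_Zfun (epsY epsX : ℕ → ℕ → F) (γ : ℕ → F) :
    toIncidence (fun a b => (-1) ^ (b - a) * Zfun epsY epsX γ (a + 1) b)
      = toIncidence (fun a b =>
          ((-1) ^ (b - a) * epsE epsY (a + 1) b) / ∏ j ∈ Finset.Icc (a + 1) b, γ j) *
        toIncidence (fun a b => (-1) ^ (b - a) * epsE epsX (a + 1) b) := by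
  refine IncidenceAlgebra.ext fun a b hab => ?_
  rw [toIncidence_apply _ hab, toIncidence_mul_apply, Zfun, Finset.mul_sum, Nat.add_sub_cancel]
  refine Finset.sum_congr rfl fun k hk => ?_
  rw [Finset.mem_Icc] at hk
  have hexp : b - a = (k - a) + (b - k) := by omega
  rw [hexp, pow_add]
  ring

lemma toIncidence_ZstarFun (epsStarX epsStarY : ℕ → ℕ → F) (γ : ℕ → F) :
    toIncidence (fun a b => ZstarFun epsStarX epsStarY γ (a + 1) b)
      = toIncidence (fun a b => epsE epsStarX (a + 1) b) *
        toIncidence (fun a b =>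
          epsE epsStarY (a + 1) b / ∏ j ∈ Finset.Icc (a + 1) b, γ j) := by
  refine IncidenceAlgebra.ext fun a b hab => ?_
  rw [toIncidence_apply _ hab, toIncidence_mul_apply, ZstarFun, Nat.add_sub_cancel]
  exact Finset.sum_congr rfl fun k _ => mul_div_assoc _ _ _

/-- The product families satisfy the alternating convolution relation. -/
lemma alternating_sum_Zfun_mul_ZstarFun {n : ℕ} {epsX epsStarX epsY epsStarY : ℕ → ℕ → F}
    (γ : ℕ → F)
    (hX : ∀ s t : ℕ, 1 ≤ s → s ≤ t → t ≤ n →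
      ∑ j ∈ Finset.Icc (s - 1) t,
        (-1) ^ (j + 1 - s) * epsE epsX s j * epsE epsStarX (j + 1) t = 0)
    (hY : ∀ s t : ℕ, 1 ≤ s → s ≤ t → t ≤ n →
      ∑ j ∈ Finset.Icc (s - 1) t,
        (-1) ^ (j + 1 - s) * epsE epsY s j * epsE epsStarY (j + 1) t = 0)
    (s t : ℕ) (hs : 1 ≤ s) (hst : s ≤ t) (ht : t ≤ n) :
    ∑ j ∈ Finset.Icc (s - 1) t,
      (-1) ^ (j + 1 - s) * Zfun epsY epsX γ s j * ZstarFun epsStarX epsStarY γ (j + 1) t = 0 := by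
  obtain ⟨a, rfl⟩ : ∃ a, s = a + 1 := ⟨s - 1, by omega⟩
  have key : (toIncidence (fun a b => (-1) ^ (b - a) * Zfun epsY epsX γ (a + 1) b) *
      toIncidence (fun a b => ZstarFun epsStarX epsStarY γ (a + 1) b)) a t = 0 := by
    rw [toIncidence_Zfun, toIncidence_ZstarFun, mul_assoc, ← mul_assoc (toIncidence _)
      (toIncidence _) (toIncidence _), IncidenceAlgebra.mul_apply]
    simp_rw [mul_apply_of_eq_one
      (fun k hk => toIncidence_mul_eq_one hX _ k (hk.trans ht))]
    rw [← IncidenceAlgebra.mul_apply, toIncidence_div_prod_mul_apply,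
      toIncidence_mul_eq_one hY a t ht, IncidenceAlgebra.one_apply,
      if_neg (Nat.lt_of_succ_le hst).ne, zero_div]
  rw [toIncidence_mul_apply] at key
  simpa using key

end Product

end EpsSys

/-- if the pairs `(ε^X, ε*^X)` and `(ε^Y, ε*^Y)` each satisfy the alternating
convolution relation `Σ_{j=s−1}^{t} (−1)^{j−s+1} ε_{[s,j]} ε*_{[j+1,t]} = 0` for all
`1 ≤ s ≤ t ≤ n`, and `γ₁,…,γ_n` are nonzero, then the product families `Z`, `Z*` also
satisfy it; equivalently, `Z*_J` equals the partition sum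
`Σ_{P partition of J} (−1)^{|J|−l(P)} Z_P` for every interval `J`. -/
theorem stmt6 {F : Type*} [Field F] (n : ℕ) (hn : 1 ≤ n)
    (epsX epsStarX epsY epsStarY : ℕ → ℕ → F) (γ : ℕ → F)
    (hX : ∀ s t : ℕ, 1 ≤ s → s ≤ t → t ≤ n →
      (∑ j ∈ Finset.Icc (s - 1) t,
        (-1 : F) ^ (j + 1 - s) * epsE epsX s j * epsE epsStarX (j + 1) t) = 0)
    (hY : ∀ s t : ℕ, 1 ≤ s → s ≤ t → t ≤ n →
      (∑ j ∈ Finset.Icc (s - 1) t,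
        (-1 : F) ^ (j + 1 - s) * epsE epsY s j * epsE epsStarY (j + 1) t) = 0)
    (hγ : ∀ j : ℕ, 1 ≤ j → j ≤ n → γ j ≠ 0) :
    ∀ s t : ℕ, 1 ≤ s → s ≤ t → t ≤ n →
      (∑ j ∈ Finset.Icc (s - 1) t,
        (-1 : F) ^ (j + 1 - s) * Zfun epsY epsX γ s j
          * ZstarFun epsStarX epsStarY γ (j + 1) t) = 0 ∧
      ZstarFun epsStarX epsStarY γ s t
        = epsStar (fun a b => Zfun epsY epsX γ a b) s t := by
  have hsum := alternating_sum_Zfun_mul_ZstarFun γ hX hY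
  intro s t hs hst ht
  refine ⟨hsum s t hs hst ht, ?_⟩
  refine eq_epsStar_of_alternating_sum_eq_zero (fun s hs => ?_) (ZstarFun_succ_self _ _ γ) hsum
    hs (by omega) ht
  obtain ⟨a, rfl⟩ : ∃ a, s = a + 1 := ⟨s - 1, by omega⟩
  exact Zfun_succ_self epsY epsX γ a
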